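/- arXiv:0907.4936 — 8 statements merged into one kernel-verified Lean document; each statement's English description precedes it below -/
import Mathlib

section
/- Let F be a field and q ∈ F a nonzero element with q + q⁻¹ ≠ 0. For all integers i, j with |i − j| = 1 and q(j) ≠ q(i), one has (ξ²/(q(j) − q(i))²)·(q(i)q(j) − 4) = 1; equivalently ξ²·(q(i)q(j) − 4) = (q(j) − q(i))². -/
/-- `q(i) = 2 (q^{2i+1} + q^{-(2i+1)}) / (q + q⁻¹)`. -/
def qval {F : Type*} [Field F] (q : F) (i : ℤ) : F :=
  2 * (q ^ (2 * i + 1) + q ^ (-(2 * i + 1))) / (q + q⁻¹)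

/-- `ξ = q - q⁻¹`. -/
def xival {F : Type*} [Field F] (q : F) : F := q - q⁻¹

theorem xival_sq_mul_qval_succ {F : Type*} [Field F] (q : F) (hq : q ≠ 0) (hsum : q + q⁻¹ ≠ 0)
    (i : ℤ) :
    (xival q) ^ 2 * (qval q i * qval q (i + 1) - 4) = (qval q (i + 1) - qval q i) ^ 2 := by
  have hsucc : q ^ (2 * (i + 1) + 1) = q ^ (2 * i + 1) * q ^ 2 := by
    rw [← zpow_natCast q 2, ← zpow_add₀ hq]
    congr 1
    push_cast
    ring
  have ha : q ^ (2 * i + 1) ≠ 0 := zpow_ne_zero _ hq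
  have hs : q ^ 2 + 1 ≠ 0 := by
    intro h
    apply hsum
    field_simp
    rw [h, mul_zero]
  simp only [xival, qval, zpow_neg, hsucc]
  generalize q ^ (2 * i + 1) = a at ha
  field_simp
  ring

/-- Corollary 5.3: for `|i - j| = 1` and `q(j) ≠ q(i)`,
`(ξ²/(q(j) − q(i))²)·(q(i)q(j) − 4) = 1`; equivalently
`ξ²·(q(i)q(j) − 4) = (q(j) − q(i))²`. -/
theorem stmt_0 {F : Type*} [Field F] (q : F) (hq : q ≠ 0) (hsum : q + q⁻¹ ≠ 0)
    (i j : ℤ) (hij : |i - j| = 1) (hne : qval q j ≠ qval q i) :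
    (xival q) ^ 2 / (qval q j - qval q i) ^ 2 * (qval q i * qval q j - 4) = 1 ∧
      (xival q) ^ 2 * (qval q i * qval q j - 4) = (qval q j - qval q i) ^ 2 := by
  have key : (xival q) ^ 2 * (qval q i * qval q j - 4) = (qval q j - qval q i) ^ 2 := by
    rcases (abs_eq zero_le_one).mp hij with h | h
    · obtain rfl : i = j + 1 := by omega
      linear_combination xival_sq_mul_qval_succ q hq hsum j
    · obtain rfl : j = i + 1 := by omega
      exact xival_sq_mul_qval_succ q hq hsum i
  refine ⟨?_, key⟩
  rw [div_mul_eq_mul_div, key]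
  exact div_self (pow_ne_zero 2 (sub_ne_zero.mpr hne))
end

section
/- Let F be a field and q ∈ F a nonzero element with q + q⁻¹ ≠ 0. Suppose i, j are integers with |i − j| ≤ 1 and a, b ∈ F are nonzero elements with a + a⁻¹ = q(i) and b + b⁻¹ = q(j). Then a⁻²(ab − 1)²(ab⁻¹ − 1)²·(a⁻²(ab − 1)²(ab⁻¹ − 1)² − ξ²a⁻¹b⁻¹(ab − 1)² − ξ²a⁻¹b(ab⁻¹ − 1)²) = 0. -/
/-- The values `q(i)` and `q(i + 1)` satisfy `(A - B)² = ξ² (A B - 4)`. -/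
theorem sq_qval_sub_qval_add_one {F : Type*} [Field F] (q : F) (hq : q ≠ 0)
    (hsum : q + q⁻¹ ≠ 0) (i : ℤ) :
    (qval q i - qval q (i + 1)) ^ 2 = xival q ^ 2 * (qval q i * qval q (i + 1) - 4) := by
  obtain ⟨y, hy⟩ : ∃ y, y = q ^ (2 * i + 2) := ⟨_, rfl⟩
  have hy0 : y ≠ 0 := hy ▸ zpow_ne_zero _ hq
  have h₁ : q ^ (2 * i + 1) = y * q⁻¹ := by
    rw [hy, ← zpow_sub_one₀ hq]
    congr 1
    ring
  have h₂ : q ^ (2 * (i + 1) + 1) = y * q := by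
    rw [hy, ← zpow_add_one₀ hq]
    congr 1
    ring
  have hs : q ^ 2 + 1 ≠ 0 := by
    intro h
    apply hsum
    field_simp
    simpa using h
  simp only [qval, xival, zpow_neg, h₁, h₂]
  field_simp
  ring

/-- Neighbouring values `A = q(i)`, `B = q(j)` satisfy `(A - B)² ((A - B)² - ξ² (A B - 4)) = 0`. -/
theorem qval_relation_of_abs_sub_le_one {F : Type*} [Field F] (q : F) (hq : q ≠ 0)
    (hsum : q + q⁻¹ ≠ 0) (i j : ℤ) (hij : |i - j| ≤ 1) :
    (qval q i - qval q j) ^ 2 *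
      ((qval q i - qval q j) ^ 2 - xival q ^ 2 * (qval q i * qval q j - 4)) = 0 := by
  rw [abs_le] at hij
  obtain rfl | rfl | rfl : j = i ∨ j = i + 1 ∨ i = j + 1 := by omega
  · simp
  · rw [sq_qval_sub_qval_add_one q hq hsum i]
    ring
  · linear_combination (qval q (j + 1) - qval q j) ^ 2 * sq_qval_sub_qval_add_one q hq hsum j

/-- Lemma 5.2: if `|i − j| ≤ 1` and `a + a⁻¹ = q(i)`, `b + b⁻¹ = q(j)` for nonzero `a, b`, then
`a⁻²(ab − 1)²(ab⁻¹ − 1)²·(a⁻²(ab − 1)²(ab⁻¹ − 1)² − ξ²a⁻¹b⁻¹(ab − 1)² − ξ²a⁻¹b(ab⁻¹ − 1)²) = 0`. -/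
theorem stmt_2 {F : Type*} [Field F] (q : F) (hq : q ≠ 0) (hsum : q + q⁻¹ ≠ 0)
    (i j : ℤ) (hij : |i - j| ≤ 1) (a b : F) (ha : a ≠ 0) (hb : b ≠ 0)
    (haq : a + a⁻¹ = qval q i) (hbq : b + b⁻¹ = qval q j) :
    a⁻¹ ^ 2 * (a * b - 1) ^ 2 * (a * b⁻¹ - 1) ^ 2 *
        (a⁻¹ ^ 2 * (a * b - 1) ^ 2 * (a * b⁻¹ - 1) ^ 2
          - (xival q) ^ 2 * a⁻¹ * b⁻¹ * (a * b - 1) ^ 2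
          - (xival q) ^ 2 * a⁻¹ * b * (a * b⁻¹ - 1) ^ 2) = 0 := by
  have key := qval_relation_of_abs_sub_le_one q hq hsum i j hij
  rw [← haq, ← hbq] at key
  have hdiff : a⁻¹ ^ 2 * (a * b - 1) ^ 2 * (a * b⁻¹ - 1) ^ 2 = (a + a⁻¹ - (b + b⁻¹)) ^ 2 := by
    field_simp
    ring
  have hprod : a⁻¹ * b⁻¹ * (a * b - 1) ^ 2 + a⁻¹ * b * (a * b⁻¹ - 1) ^ 2
      = (a + a⁻¹) * (b + b⁻¹) - 4 := by
    field_simp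
    ring
  rw [hdiff]
  linear_combination key - (a + a⁻¹ - (b + b⁻¹)) ^ 2 * xival q ^ 2 * hprod
end

section
/- Let l ≥ 3 be an integer, F a field, and q ∈ F a primitive 4l-th root of unity. Then q + q⁻¹ ≠ 0, and for all integers i, j with 1 ≤ i ≤ l − 2 and |i − j| = 1 one has q(i)q(j) + q(j)² − 8 ≠ 0. -/
/-- A primitive root of even order `2 * n` with `n ≠ 0` only exists when `2 ≠ 0`. -/
theorem IsPrimitiveRoot.two_ne_zero_of_even {F : Type*} [Field F] {n : ℕ} (hn : n ≠ 0) {q : F}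
    (hq : IsPrimitiveRoot q (2 * n)) : (2 : F) ≠ 0 := by
  intro h2
  have h : (q ^ n - 1) ^ 2 = 0 := by
    have h1 : (q ^ n) ^ 2 = 1 := by rw [← pow_mul, mul_comm, hq.pow_eq_one]
    linear_combination h1 + (1 - q ^ n) * h2
  have hd := hq.dvd_of_pow_eq_one n (sub_eq_zero.mp (pow_eq_zero_iff two_ne_zero |>.mp h))
  have := Nat.le_of_dvd (Nat.pos_of_ne_zero hn) hd
  omega

theorem qval_succ_factorization {F : Type*} [Field F] {q : F} (hq : q ≠ 0)
    (hs : q + q⁻¹ ≠ 0) (i : ℤ) :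
    (qval q i * qval q (i + 1) + (qval q (i + 1)) ^ 2 - 8) * ((q + q⁻¹) * q ^ (4 * i + 5)) =
      4 * ((q ^ (4 * i + 6) - 1) * (q ^ (4 * i + 4) - 1)) := by
  have ha : q ^ i ≠ 0 := zpow_ne_zero i hq
  have hs' : q ^ 2 + 1 ≠ 0 := fun h => hs (by field_simp; simpa using h)
  have e (m k : ℕ) : q ^ (m * i + k) = (q ^ i) ^ m * q ^ k := by
    rw [zpow_add₀ hq, mul_comm (m : ℤ), zpow_mul, zpow_natCast, zpow_natCast]
  have e1 : q ^ (2 * i + 1) = (q ^ i) ^ 2 * q := by simpa using e 2 1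
  have e3 : q ^ (2 * (i + 1) + 1) = (q ^ i) ^ 2 * q ^ 3 := by
    rw [show 2 * (i + 1) + 1 = 2 * i + (3 : ℕ) by push_cast; ring]; exact e 2 3
  have e4 : q ^ (4 * i + 4) = (q ^ i) ^ 4 * q ^ 4 := e 4 4
  have e5 : q ^ (4 * i + 5) = (q ^ i) ^ 4 * q ^ 5 := e 4 5
  have e6 : q ^ (4 * i + 6) = (q ^ i) ^ 4 * q ^ 6 := e 4 6
  simp only [qval, zpow_neg, e1, e3, e4, e5, e6]
  generalize q ^ i = a at ha
  field_simp
  ring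

theorem qval_neg_sub_one {F : Type*} [Field F] (q : F) (i : ℤ) :
    qval q (-i - 1) = qval q i := by
  simp only [qval]
  rw [show 2 * (-i - 1) + 1 = -(2 * i + 1) by ring, neg_neg, add_comm (q ^ (-(2 * i + 1)))]

/-- The nonvanishing established in the proof of Corollary 5.6: for `q` a primitive
`4l`-th root of unity with `l ≥ 3`, one has `q + q⁻¹ ≠ 0`, and for all integers `i, j` with
`1 ≤ i ≤ l − 2` and `|i − j| = 1`, `q(i)q(j) + q(j)² − 8 ≠ 0`. -/
theorem stmt_5 {F : Type*} [Field F] (l : ℕ) (hl : 3 ≤ l) (q : F)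
    (hq : IsPrimitiveRoot q (4 * l)) :
    q + q⁻¹ ≠ 0 ∧
      ∀ i j : ℤ, 1 ≤ i → i ≤ (l : ℤ) - 2 → |i - j| = 1 →
        qval q i * qval q j + (qval q j) ^ 2 - 8 ≠ 0 := by
  have hq0 : q ≠ 0 := hq.ne_zero (by omega)
  have hs : q + q⁻¹ ≠ 0 := by
    intro h
    have h2 : q ^ 2 + 1 = 0 := by field_simp at h; simpa using h
    have h4 : q ^ 4 = 1 := by linear_combination (q ^ 2 - 1) * h2
    have := Nat.le_of_dvd (by norm_num) (hq.dvd_of_pow_eq_one 4 h4)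
    omega
  have h2 : (2 : F) ≠ 0 :=
    IsPrimitiveRoot.two_ne_zero_of_even (n := 2 * l) (by omega) (by convert hq using 1; ring)
  have h4 : (4 : F) ≠ 0 := by
    rw [show (4 : F) = 2 * 2 by norm_num]; exact mul_ne_zero h2 h2
  have key (k : ℤ) (hk : ¬ (l : ℤ) ∣ k + 1) :
      qval q k * qval q (k + 1) + (qval q (k + 1)) ^ 2 - 8 ≠ 0 := by
    intro h
    have hf := qval_succ_factorization hq0 hs k
    rw [h, zero_mul, eq_comm, mul_eq_zero, or_iff_right h4, mul_eq_zero, sub_eq_zero,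
      sub_eq_zero, hq.zpow_eq_one_iff_dvd, hq.zpow_eq_one_iff_dvd] at hf
    push_cast at hf
    rcases hf with ⟨c, hc⟩ | ⟨c, hc⟩
    · rw [mul_assoc] at hc
      omega
    · exact hk ⟨c, by linarith⟩
  refine ⟨hs, fun i j hi hil hij => ?_⟩
  rcases (abs_eq zero_le_one).mp hij with h | h
  · obtain rfl : j = i - 1 := by omega
    have hk := key (-i - 1) fun hd => by
      have := Int.le_of_dvd (by omega) (show (l : ℤ) ∣ i by simpa using hd)
      omega
    rwa [qval_neg_sub_one, show -i - 1 + 1 = -(i - 1) - 1 by ring, qval_neg_sub_one] at hk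
  · obtain rfl : j = i + 1 := by omega
    exact key i fun hd => by
      have := Int.le_of_dvd (by omega) hd
      omega
end

section
/- Let l ≥ 2 be an integer, F a field, and q ∈ F a primitive 4l-th root of unity. Then q + q⁻¹ ≠ 0, q(0) = 2, q(l − 1) = −2, and for every integer i with 1 ≤ i ≤ l − 2 one has q(i) ≠ 2 and q(i) ≠ −2. -/
theorem add_inv_eq_add_inv {F : Type*} [Field F] {x y : F} (hx : x ≠ 0) (hy : y ≠ 0)
    (h : x + x⁻¹ = y + y⁻¹) : x = y ∨ x * y = 1 := by
  field_simp at h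
  have h' : (x - y) * (x * y - 1) = 0 := by linear_combination h
  rcases mul_eq_zero.mp h' with h | h
  · exact Or.inl (sub_eq_zero.mp h)
  · exact Or.inr (sub_eq_zero.mp h)

theorem IsPrimitiveRoot.dvd_sub_or_dvd_add {F : Type*} [Field F] {q : F} {n : ℕ}
    (hq : IsPrimitiveRoot q n) (hq0 : q ≠ 0) {k m : ℤ}
    (h : q ^ k + q ^ (-k) = q ^ m + q ^ (-m)) : (n : ℤ) ∣ k - m ∨ (n : ℤ) ∣ k + m := by
  rw [zpow_neg, zpow_neg] at h
  rcases add_inv_eq_add_inv (zpow_ne_zero _ hq0) (zpow_ne_zero _ hq0) h with h | h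
  · left
    rw [← hq.zpow_eq_one_iff_dvd, zpow_sub₀ hq0, h, div_self (zpow_ne_zero _ hq0)]
  · right
    rwa [← hq.zpow_eq_one_iff_dvd, zpow_add₀ hq0]

theorem IsPrimitiveRoot.pow_half_eq_neg_one {F : Type*} [Field F] {q : F} {n : ℕ} (hn : n ≠ 0)
    (hq : IsPrimitiveRoot q (2 * n)) : q ^ n = -1 := by
  have h : q ^ n * q ^ n = 1 := by rw [← pow_add, ← two_mul, hq.pow_eq_one]
  exact (mul_self_eq_one_iff.mp h).resolve_left
    (hq.pow_ne_one_of_pos_of_lt hn (by omega))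

theorem not_dvd_of_pos_of_lt {n a : ℤ} (h0 : 0 < a) (h : a < n) : ¬ n ∣ a :=
  fun hd => absurd (Int.le_of_dvd h0 hd) (not_le.mpr h)

/-- For `q` a primitive `4l`-th root of unity with `l ≥ 2`: `q + q⁻¹ ≠ 0`, `q(0) = 2`,
`q(l − 1) = −2`, and `q(i) ≠ ±2` for every integer `i` with `1 ≤ i ≤ l − 2`. -/
theorem stmt_6 {F : Type*} [Field F] (l : ℕ) (hl : 2 ≤ l) (q : F)
    (hq : IsPrimitiveRoot q (4 * l)) :
    q + q⁻¹ ≠ 0 ∧ qval q 0 = 2 ∧ qval q ((l : ℤ) - 1) = -2 ∧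
      ∀ i : ℤ, 1 ≤ i → i ≤ (l : ℤ) - 2 → qval q i ≠ 2 ∧ qval q i ≠ -2 := by
  have hq0 : q ≠ 0 := hq.ne_zero (by omega)
  have half : q ^ (2 * l) = -1 :=
    IsPrimitiveRoot.pow_half_eq_neg_one (by omega) (by rwa [← mul_assoc])
  have halfz : q ^ (2 * (l : ℤ)) = -1 := by exact_mod_cast half
  have two_ne : (2 : F) ≠ 0 := by
    intro h
    refine hq.pow_ne_one_of_pos_of_lt (l := 2 * l) (by omega) (by omega) ?_
    linear_combination half - h
  have hne : q + q⁻¹ ≠ 0 := by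
    intro h
    field_simp at h
    refine hq.pow_ne_one_of_pos_of_lt (l := 4) (by omega) (by omega) ?_
    linear_combination (q ^ 2 - 1) * h
  have shift : q ^ (2 * (l : ℤ) + 1) = -q := by
    rw [zpow_add₀ hq0, halfz, zpow_one, neg_one_mul]
  refine ⟨hne, ?_, ?_, fun i h1 h2 => ⟨fun h => ?_, fun h => ?_⟩⟩
  · simp [qval, hne]
  · have e : q ^ (2 * ((l : ℤ) - 1) + 1) = -q⁻¹ := by
      rw [show 2 * ((l : ℤ) - 1) + 1 = 2 * l + -1 by ring, zpow_add₀ hq0, halfz, zpow_neg_one,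
        neg_one_mul]
    rw [qval, zpow_neg, e, div_eq_iff hne, inv_neg, inv_inv]
    ring
  · rw [qval, div_eq_iff hne] at h
    have h' : q ^ (2 * i + 1) + q ^ (-(2 * i + 1)) = q ^ (1 : ℤ) + q ^ (-1 : ℤ) := by
      rw [zpow_one, zpow_neg_one]
      exact mul_left_cancel₀ two_ne h
    rcases hq.dvd_sub_or_dvd_add hq0 h' with hd | hd <;>
      exact not_dvd_of_pos_of_lt (by omega) (by push_cast; omega) hd
  · rw [qval, div_eq_iff hne] at h
    have h' : q ^ (2 * i + 1) + q ^ (-(2 * i + 1)) =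
        q ^ (2 * (l : ℤ) + 1) + q ^ (-(2 * (l : ℤ) + 1)) := by
      rw [zpow_neg q (2 * (l : ℤ) + 1), shift, inv_neg]
      refine mul_left_cancel₀ two_ne ?_
      linear_combination h
    rcases hq.dvd_sub_or_dvd_add hq0 h' with hd | hd
    · exact not_dvd_of_pos_of_lt (by omega) (by push_cast; omega) ((dvd_neg).mpr hd)
    · exact not_dvd_of_pos_of_lt (by omega) (by push_cast; omega) hd
end

section
/- Let l ≥ 2 be an integer, F a field, and q ∈ F a primitive 4l-th root of unity. Then the values q(0), q(1), …, q(l − 1) are pairwise distinct, and for every integer i there exists a unique k with 0 ≤ k ≤ l − 1 and q(i) = q(k). -/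
theorem add_inv_eq_add_inv_iff {F : Type*} [Field F] {a b : F} (ha : a ≠ 0) (hb : b ≠ 0) :
    a + a⁻¹ = b + b⁻¹ ↔ a * b⁻¹ = 1 ∨ a * b = 1 := by
  have key : a + a⁻¹ - (b + b⁻¹) = (a * b⁻¹ - 1) * (a * b - 1) * a⁻¹ := by
    field_simp
    ring
  rw [← sub_eq_zero, key]
  simp [ha, sub_eq_zero]

theorem IsPrimitiveRoot.two_ne_zero_of_four_mul {F : Type*} [Field F] {l : ℕ} (hl : 0 < l)
    {q : F} (hq : IsPrimitiveRoot q (4 * l)) : (2 : F) ≠ 0 := by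
  intro h2
  have hsq : (q ^ (2 * l) - 1) ^ 2 = 0 := by
    have h1 : q ^ (2 * l) * q ^ (2 * l) = 1 := by
      rw [← pow_add, ← hq.pow_eq_one]
      congr 1
      ring
    linear_combination h1 + (1 - q ^ (2 * l)) * h2
  exact hq.pow_ne_one_of_pos_of_lt (by omega) (by omega)
    (sub_eq_zero.mp (pow_eq_zero_iff two_ne_zero |>.mp hsq))

theorem IsPrimitiveRoot.add_inv_ne_zero_of_four_mul {F : Type*} [Field F] {l : ℕ} (hl : 2 ≤ l)
    {q : F} (hq : IsPrimitiveRoot q (4 * l)) : q + q⁻¹ ≠ 0 := by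
  intro h
  have hq0 : q ≠ 0 := hq.ne_zero (by omega)
  have hsq : q ^ 2 + 1 = 0 := by
    field_simp at h
    simpa using h
  have h4 : q ^ 4 = 1 := by linear_combination (q ^ 2 - 1) * hsq
  exact hq.pow_ne_one_of_pos_of_lt (by omega) (by omega) h4

theorem qval_eq_qval_iff {F : Type*} [Field F] {l : ℕ} (hl : 2 ≤ l) {q : F}
    (hq : IsPrimitiveRoot q (4 * l)) (i k : ℤ) :
    qval q i = qval q k ↔ 2 * (l : ℤ) ∣ i - k ∨ 2 * (l : ℤ) ∣ i + k + 1 := by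
  have hq0 : q ≠ 0 := hq.ne_zero (by omega)
  have hdvd (n : ℤ) : q ^ (2 * n) = 1 ↔ 2 * (l : ℤ) ∣ n := by
    rw [hq.zpow_eq_one_iff_dvd, ← mul_dvd_mul_iff_left (b := 2 * (l : ℤ)) (two_ne_zero (α := ℤ)),
      ← mul_assoc]
    norm_num
  unfold qval
  rw [div_left_inj' (hq.add_inv_ne_zero_of_four_mul hl),
    mul_right_inj' (hq.two_ne_zero_of_four_mul (by omega)), zpow_neg, zpow_neg,
    add_inv_eq_add_inv_iff (zpow_ne_zero _ hq0) (zpow_ne_zero _ hq0), ← zpow_neg,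
    ← zpow_add₀ hq0, ← zpow_add₀ hq0, ← hdvd, ← hdvd]
  ring_nf

theorem qval_injOn {F : Type*} [Field F] {l : ℕ} (hl : 2 ≤ l) {q : F}
    (hq : IsPrimitiveRoot q (4 * l)) : Set.InjOn (qval q) (Set.Icc 0 ((l : ℤ) - 1)) := by
  rintro k ⟨hk0, hkl⟩ m ⟨hm0, hml⟩ h
  rcases (qval_eq_qval_iff hl hq k m).mp h with h | h
  · have := Int.eq_zero_of_abs_lt_dvd h (by rw [abs_lt]; constructor <;> linarith)
    linarith
  · have := Int.le_of_dvd (by linarith) h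
    linarith

theorem exists_qval_eq {F : Type*} [Field F] {l : ℕ} (hl : 2 ≤ l) {q : F}
    (hq : IsPrimitiveRoot q (4 * l)) (i : ℤ) :
    ∃ k ∈ Set.Icc 0 ((l : ℤ) - 1), qval q i = qval q k := by
  have h0 := Int.emod_nonneg i (b := 2 * (l : ℤ)) (by omega)
  have h1 := Int.emod_lt_of_pos i (b := 2 * (l : ℤ)) (by omega)
  have h2 := Int.emod_add_mul_ediv i (2 * (l : ℤ))
  by_cases hr : i % (2 * (l : ℤ)) < l
  · exact ⟨i % (2 * (l : ℤ)), ⟨h0, by linarith [Int.add_one_le_of_lt hr]⟩,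
      (qval_eq_qval_iff hl hq _ _).mpr (.inl ⟨i / (2 * (l : ℤ)), by linarith⟩)⟩
  · exact ⟨2 * (l : ℤ) - 1 - i % (2 * (l : ℤ)),
      ⟨by linarith [Int.add_one_le_of_lt h1], by linarith⟩,
      (qval_eq_qval_iff hl hq _ _).mpr (.inr ⟨i / (2 * (l : ℤ)) + 1, by linarith⟩)⟩

/-- For `q` a primitive `4l`-th root of unity with `l ≥ 2`, the values `q(0), …, q(l − 1)` are
pairwise distinct, and every `q(i)` (`i ∈ ℤ`) equals `q(k)` for a unique `0 ≤ k ≤ l − 1`. -/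
theorem stmt_8 {F : Type*} [Field F] (l : ℕ) (hl : 2 ≤ l) (q : F)
    (hq : IsPrimitiveRoot q (4 * l)) :
    (∀ k m : ℤ, 0 ≤ k → k < m → m ≤ (l : ℤ) - 1 → qval q k ≠ qval q m) ∧
      ∀ i : ℤ, ∃! k : ℤ, 0 ≤ k ∧ k ≤ (l : ℤ) - 1 ∧ qval q i = qval q k := by
  refine ⟨fun k m hk hkm hm h ↦ hkm.ne ?_, fun i ↦ ?_⟩
  · exact qval_injOn hl hq ⟨hk, by linarith⟩ ⟨by linarith, hm⟩ h
  · obtain ⟨k, hk, hik⟩ := exists_qval_eq hl hq i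
    exact ⟨k, ⟨hk.1, hk.2, hik⟩, fun m hm ↦
      qval_injOn hl hq ⟨hm.1, hm.2.1⟩ hk (hm.2.2.symm.trans hik)⟩
end

section
/- Let F be a field and q ∈ F a primitive 8th root of unity; set ξ = q − q⁻¹. The 2×2 matrices over F given by X₁ = [[1,0],[0,1]], X₂ = [[−1,0],[0,−1]], C₁ = [[0,1],[1,0]], C₂ = [[0,−q²],[q²,0]], T₁ = [[q,0],[0,q³]] satisfy all the defining relations of the affine Hecke–Clifford superalgebra H₂ with parameter ξ (here X₁⁻¹ = X₁ and X₂⁻¹ = X₂); in particular C₁² = C₂² = 1, C₁C₂ = −C₂C₁, T₁² = ξT₁ + 1, T₁C₁ = C₂T₁, and (T₁ + ξC₁C₂)X₁T₁ = X₂. -/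
/-- Lemma 5.13: for `q` a primitive 8th root of unity and `ξ = q − q⁻¹`, the displayed
`2×2` matrices satisfy all the defining relations of the affine Hecke–Clifford superalgebra
`H₂` with parameter `ξ` (with `X₁⁻¹ = X₁` and `X₂⁻¹ = X₂`). -/
theorem stmt_10 {F : Type*} [Field F] (q : F) (hq : IsPrimitiveRoot q 8)
    (ξ : F) (hξ : ξ = q - q⁻¹)
    (X₁ X₂ C₁ C₂ T₁ : Matrix (Fin 2) (Fin 2) F)
    (hX₁ : X₁ = !![1, 0; 0, 1])
    (hX₂ : X₂ = !![-1, 0; 0, -1])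
    (hC₁ : C₁ = !![0, 1; 1, 0])
    (hC₂ : C₂ = !![0, -q ^ 2; q ^ 2, 0])
    (hT₁ : T₁ = !![q, 0; 0, q ^ 3]) :
    -- the `Xᵢ` are invertible with `X₁⁻¹ = X₁`, `X₂⁻¹ = X₂`, and commute
    X₁ * X₁ = 1 ∧ X₂ * X₂ = 1 ∧ X₁ * X₂ = X₂ * X₁ ∧
    -- Clifford relations
    C₁ * C₁ = 1 ∧ C₂ * C₂ = 1 ∧ C₁ * C₂ = -(C₂ * C₁) ∧
    -- Hecke relation
    T₁ * T₁ = ξ • T₁ + 1 ∧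
    -- mixed `C`/`X` relations (`CᵢXᵢ = Xᵢ⁻¹Cᵢ` with `Xᵢ⁻¹ = Xᵢ`)
    C₁ * X₁ = X₁ * C₁ ∧ C₂ * X₂ = X₂ * C₂ ∧
    C₁ * X₂ = X₂ * C₁ ∧ C₂ * X₁ = X₁ * C₂ ∧
    -- mixed `T`/`C` and `T`/`X` relations
    T₁ * C₁ = C₂ * T₁ ∧ (T₁ + ξ • (C₁ * C₂)) * X₁ * T₁ = X₂ := by
  have hq4 : q ^ 4 = -1 := by
    have hsq : (q ^ 4) ^ 2 = 1 := by rw [← pow_mul]; exact hq.pow_eq_one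
    exact (sq_eq_one_iff.mp hsq).resolve_left (hq.pow_ne_one_of_pos_of_lt (by norm_num) (by norm_num))
  have hinv : q⁻¹ = -q ^ 3 := inv_eq_of_mul_eq_one_right (by linear_combination -hq4)
  rw [hinv] at hξ
  subst hξ hX₁ hX₂ hC₁ hC₂ hT₁
  refine ⟨?_, ?_, ?_, ?_, ?_, ?_, ?_, ?_, ?_, ?_, ?_, ?_, ?_⟩ <;> ext i j <;>
    fin_cases i <;> fin_cases j <;> simp [Matrix.mul_apply, Fin.sum_univ_two] <;> grind
end

section
/- Let F be a field and q ∈ F a primitive 8th root of unity; set ξ = q − q⁻¹ (note 1 + q² ≠ 0). Define 4×4 matrices over F: MX₁ = [[1,0,−2,2q],[0,1,2q,−2q²],[2,2q⁻¹,1,0],[2q⁻¹,−2q²,0,1]], MX₂ = [[−1,−2q⁻¹,0,0],[2q,3,0,0],[0,0,−1,2q],[0,0,−2q⁻¹,3]], MC₁ = [[q²,0,2q²,2q⁻¹],[0,q²,2q⁻¹,−2],[2q²,2q,−q²,0],[2q,2,0,−q²]], MC₂ = [[0,0,q²,0],[0,0,2q⁻¹,−1],[q²,0,0,0],[2q,1,0,0]],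 MC₃ = [[0,0,−1,0],[0,0,0,q²],[1,0,0,0],[0,q²,0,0]], MT₁ = [[q³,q²,−q³,−1],[0,q³,0,q],[q³,q²,q³,1],[0,q,0,q³]], and the 2×2 matrix MT₂ = [[q³+q,1],[1,0]]. Define 8×8 matrices in 4×4 blocks: X₁ = diag(MX₁, MX₁), X₂ = diag(MX₂, MX₂), X₃ = −E₈, C_j = [[0, MC_j],[−MC_j, 0]] for j = 1, 2, 3, T₁ = (1+q²)⁻¹·diag(MT₁, MT₁), and T₂ = the block-diagonal 8×8 matrix with four copies of MT₂ along the diagonal. Then X₁ and X₂ are invertible with X₁⁻¹ = 2E₈ − X₁ and X₂⁻¹ = 2E₈ − X₂, X₃⁻¹ = X₃, and these matrices satisfy all the defining relations of the affine Hecke–Clifford superalgebra H₃ with parameter ξ. -/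
open Matrix

namespace HeckeClifford

variable {R : Type*} [CommRing R]

/-- The diagonal block of `X₁`, with `q⁻¹` written as `-q ^ 3`. -/
def blockX₁ (q : R) : Matrix (Fin 4) (Fin 4) R :=
  !![1, 0, -2, 2*q; 0, 1, 2*q, -2*q^2; 2, 2*(-q^3), 1, 0; 2*(-q^3), -2*q^2, 0, 1]

/-- The diagonal block of `X₂`, with `q⁻¹` written as `-q ^ 3`. -/
def blockX₂ (q : R) : Matrix (Fin 4) (Fin 4) R :=
  !![-1, -2*(-q^3), 0, 0; 2*q, 3, 0, 0; 0, 0, -1, 2*q; 0, 0, -2*(-q^3), 3]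

/-- The off-diagonal block of `C₁`, with `q⁻¹` written as `-q ^ 3`. -/
def blockC₁ (q : R) : Matrix (Fin 4) (Fin 4) R :=
  !![q^2, 0, 2*q^2, 2*(-q^3); 0, q^2, 2*(-q^3), -2; 2*q^2, 2*q, -q^2, 0; 2*q, 2, 0, -q^2]

/-- The off-diagonal block of `C₂`, with `q⁻¹` written as `-q ^ 3`. -/
def blockC₂ (q : R) : Matrix (Fin 4) (Fin 4) R :=
  !![0, 0, q^2, 0; 0, 0, 2*(-q^3), -1; q^2, 0, 0, 0; 2*q, 1, 0, 0]

/-- The off-diagonal block of `C₃`. -/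
def blockC₃ (q : R) : Matrix (Fin 4) (Fin 4) R :=
  !![0, 0, -1, 0; 0, 0, 0, q^2; 1, 0, 0, 0; 0, q^2, 0, 0]

/-- The diagonal block of `(1 + q ^ 2) • T₁`. -/
def blockT₁ (q : R) : Matrix (Fin 4) (Fin 4) R :=
  !![q^3, q^2, -q^3, -1; 0, q^3, 0, q; q^3, q^2, q^3, 1; 0, q, 0, q^3]

/-- The diagonal block of `T₂`. -/
def blockT₂ (q : R) : Matrix (Fin 4) (Fin 4) R :=
  !![q^3 + q, 1, 0, 0; 1, 0, 0, 0; 0, 0, q^3 + q, 1; 0, 0, 1, 0]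

variable {q : R}

theorem blockX₁_mul_two_sub (hq : q ^ 4 = -1) :
    blockX₁ q * (2 - blockX₁ q) = 1 := by
  ext i j
  fin_cases i <;> fin_cases j <;>
    simp [blockX₁, mul_apply, Fin.sum_univ_four, ofNat_apply] <;> grind

theorem blockX₂_mul_two_sub (hq : q ^ 4 = -1) :
    blockX₂ q * (2 - blockX₂ q) = 1 := by
  ext i j
  fin_cases i <;> fin_cases j <;>
    simp [blockX₂, mul_apply, Fin.sum_univ_four, ofNat_apply] <;> grind

theorem blockX₁_mul_blockX₂ (hq : q ^ 4 = -1) :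
    blockX₁ q * blockX₂ q = blockX₂ q * blockX₁ q := by
  ext i j
  fin_cases i <;> fin_cases j <;>
    simp [blockX₁, blockX₂, mul_apply, Fin.sum_univ_four] <;> grind

theorem blockC₁_mul_self (hq : q ^ 4 = -1) :
    blockC₁ q * blockC₁ q = -1 := by
  ext i j
  fin_cases i <;> fin_cases j <;>
    simp [blockC₁, mul_apply, Fin.sum_univ_four] <;> grind

theorem blockC₂_mul_self (hq : q ^ 4 = -1) :
    blockC₂ q * blockC₂ q = -1 := by
  ext i j
  fin_cases i <;> fin_cases j <;>
    simp [blockC₂, mul_apply, Fin.sum_univ_four] <;> grind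

theorem blockC₃_mul_self (hq : q ^ 4 = -1) :
    blockC₃ q * blockC₃ q = -1 := by
  ext i j
  fin_cases i <;> fin_cases j <;>
    simp [blockC₃, mul_apply, Fin.sum_univ_four] <;> grind

theorem blockC₁_mul_blockC₂ (hq : q ^ 4 = -1) :
    blockC₁ q * blockC₂ q = -(blockC₂ q * blockC₁ q) := by
  ext i j
  fin_cases i <;> fin_cases j <;>
    simp [blockC₁, blockC₂, mul_apply, Fin.sum_univ_four] <;> grind

theorem blockC₁_mul_blockC₃ (hq : q ^ 4 = -1) :
    blockC₁ q * blockC₃ q = -(blockC₃ q * blockC₁ q) := by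
  ext i j
  fin_cases i <;> fin_cases j <;>
    simp [blockC₁, blockC₃, mul_apply, Fin.sum_univ_four] <;> grind

theorem blockC₂_mul_blockC₃ (hq : q ^ 4 = -1) :
    blockC₂ q * blockC₃ q = -(blockC₃ q * blockC₂ q) := by
  ext i j
  fin_cases i <;> fin_cases j <;>
    simp [blockC₂, blockC₃, mul_apply, Fin.sum_univ_four] <;> grind

theorem blockT₁_mul_self (hq : q ^ 4 = -1) :
    blockT₁ q * blockT₁ q = ((1 + q ^ 2) * (q + q ^ 3)) • blockT₁ q + ((1 + q ^ 2) ^ 2) • 1 := by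
  ext i j
  fin_cases i <;> fin_cases j <;>
    simp [blockT₁, mul_apply, Fin.sum_univ_four] <;> grind

theorem blockT₂_mul_self :
    blockT₂ q * blockT₂ q = (q + q ^ 3) • blockT₂ q + 1 := by
  ext i j
  fin_cases i <;> fin_cases j <;>
    simp [blockT₂, mul_apply, Fin.sum_univ_four] <;> grind

theorem blockT₁_braid_blockT₂ (hq : q ^ 4 = -1) :
    blockT₁ q * blockT₂ q * blockT₁ q = (1 + q ^ 2) • (blockT₂ q * blockT₁ q * blockT₂ q) := by
  ext i j
  fin_cases i <;> fin_cases j <;>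
    simp [blockT₁, blockT₂, mul_apply, Fin.sum_univ_four] <;> grind

theorem blockC₁_mul_blockX₁ (hq : q ^ 4 = -1) :
    blockC₁ q * blockX₁ q = (2 - blockX₁ q) * blockC₁ q := by
  ext i j
  fin_cases i <;> fin_cases j <;>
    simp [blockX₁, blockC₁, mul_apply, Fin.sum_univ_four, ofNat_apply] <;> grind

theorem blockC₂_mul_blockX₂ (hq : q ^ 4 = -1) :
    blockC₂ q * blockX₂ q = (2 - blockX₂ q) * blockC₂ q := by
  ext i j
  fin_cases i <;> fin_cases j <;>
    simp [blockX₂, blockC₂, mul_apply, Fin.sum_univ_four, ofNat_apply] <;> grind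

theorem blockC₁_mul_blockX₂ (hq : q ^ 4 = -1) :
    blockC₁ q * blockX₂ q = blockX₂ q * blockC₁ q := by
  ext i j
  fin_cases i <;> fin_cases j <;>
    simp [blockX₂, blockC₁, mul_apply, Fin.sum_univ_four] <;> grind

theorem blockC₂_mul_blockX₁ (hq : q ^ 4 = -1) :
    blockC₂ q * blockX₁ q = blockX₁ q * blockC₂ q := by
  ext i j
  fin_cases i <;> fin_cases j <;>
    simp [blockX₁, blockC₂, mul_apply, Fin.sum_univ_four] <;> grind

theorem blockC₃_mul_blockX₁ (hq : q ^ 4 = -1) :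
    blockC₃ q * blockX₁ q = blockX₁ q * blockC₃ q := by
  ext i j
  fin_cases i <;> fin_cases j <;>
    simp [blockX₁, blockC₃, mul_apply, Fin.sum_univ_four] <;> grind

theorem blockC₃_mul_blockX₂ (hq : q ^ 4 = -1) :
    blockC₃ q * blockX₂ q = blockX₂ q * blockC₃ q := by
  ext i j
  fin_cases i <;> fin_cases j <;>
    simp [blockX₂, blockC₃, mul_apply, Fin.sum_univ_four] <;> grind

theorem blockT₁_mul_blockC₁ (hq : q ^ 4 = -1) :
    blockT₁ q * blockC₁ q = blockC₂ q * blockT₁ q := by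
  ext i j
  fin_cases i <;> fin_cases j <;>
    simp [blockC₁, blockC₂, blockT₁, mul_apply, Fin.sum_univ_four] <;> grind

theorem blockT₁_intertwines_blockX₁ (hq : q ^ 4 = -1) :
    (blockT₁ q - ((1 + q ^ 2) * (q + q ^ 3)) • (blockC₁ q * blockC₂ q)) * blockX₁ q =
      blockX₂ q * (blockT₁ q - ((1 + q ^ 2) * (q + q ^ 3)) • 1) := by
  ext i j
  fin_cases i <;> fin_cases j <;>
    simp [blockX₁, blockX₂, blockC₁, blockC₂, blockT₁, mul_apply, Fin.sum_univ_four] <;> grind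

theorem blockT₂_mul_blockC₂ (hq : q ^ 4 = -1) :
    blockT₂ q * blockC₂ q = blockC₃ q * blockT₂ q := by
  ext i j
  fin_cases i <;> fin_cases j <;>
    simp [blockC₂, blockC₃, blockT₂, mul_apply, Fin.sum_univ_four] <;> grind

theorem blockT₂_intertwines_blockX₂ (hq : q ^ 4 = -1) :
    (blockT₂ q - (q + q ^ 3) • (blockC₂ q * blockC₃ q)) * blockX₂ q =
      -(blockT₂ q - (q + q ^ 3) • 1) := by
  ext i j
  fin_cases i <;> fin_cases j <;>
    simp [blockX₂, blockC₂, blockC₃, blockT₂, mul_apply, Fin.sum_univ_four] <;> grind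

theorem blockT₁_mul_blockC₃ (hq : q ^ 4 = -1) :
    blockT₁ q * blockC₃ q = blockC₃ q * blockT₁ q := by
  ext i j
  fin_cases i <;> fin_cases j <;>
    simp [blockC₃, blockT₁, mul_apply, Fin.sum_univ_four] <;> grind

theorem blockT₂_mul_blockC₁ (hq : q ^ 4 = -1) :
    blockT₂ q * blockC₁ q = blockC₁ q * blockT₂ q := by
  ext i j
  fin_cases i <;> fin_cases j <;>
    simp [blockC₁, blockT₂, mul_apply, Fin.sum_univ_four] <;> grind

theorem blockT₂_mul_blockX₁ (hq : q ^ 4 = -1) :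
    blockT₂ q * blockX₁ q = blockX₁ q * blockT₂ q := by
  ext i j
  fin_cases i <;> fin_cases j <;>
    simp [blockX₁, blockT₂, mul_apply, Fin.sum_univ_four] <;> grind

section Field

variable {F : Type*} [Field F] {q : F}

theorem smul_blockT₁_mul_self (hq : q ^ 4 = -1) (h : 1 + q ^ 2 ≠ 0) :
    ((1 + q ^ 2)⁻¹ • blockT₁ q) * ((1 + q ^ 2)⁻¹ • blockT₁ q) =
      (q + q ^ 3) • ((1 + q ^ 2)⁻¹ • blockT₁ q) + 1 := by
  rw [smul_mul_smul_comm, blockT₁_mul_self hq]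
  match_scalars <;> field_simp

theorem smul_blockT₁_braid_blockT₂ (hq : q ^ 4 = -1) (h : 1 + q ^ 2 ≠ 0) :
    ((1 + q ^ 2)⁻¹ • blockT₁ q) * blockT₂ q * ((1 + q ^ 2)⁻¹ • blockT₁ q) =
      blockT₂ q * ((1 + q ^ 2)⁻¹ • blockT₁ q) * blockT₂ q := by
  rw [smul_mul_assoc, smul_mul_smul_comm, blockT₁_braid_blockT₂ hq, mul_smul_comm, smul_mul_assoc]
  match_scalars
  field_simp

theorem smul_blockT₁_intertwines_blockX₁ (hq : q ^ 4 = -1) (h : 1 + q ^ 2 ≠ 0) :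
    ((1 + q ^ 2)⁻¹ • blockT₁ q - (q + q ^ 3) • (blockC₁ q * blockC₂ q)) * blockX₁ q *
      ((1 + q ^ 2)⁻¹ • blockT₁ q) = blockX₂ q := by
  have hX : ((1 + q ^ 2)⁻¹ • blockT₁ q - (q + q ^ 3) • (blockC₁ q * blockC₂ q)) * blockX₁ q =
      blockX₂ q * ((1 + q ^ 2)⁻¹ • blockT₁ q - (q + q ^ 3) • 1) := by
    calc
      _ = (1 + q ^ 2)⁻¹ • ((blockT₁ q - ((1 + q ^ 2) * (q + q ^ 3)) • (blockC₁ q * blockC₂ q)) *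
          blockX₁ q) := by
        rw [← smul_mul_assoc (1 + q ^ 2)⁻¹, smul_sub, smul_smul, inv_mul_cancel_left₀ h]
      _ = _ := by
        rw [blockT₁_intertwines_blockX₁ hq, ← mul_smul_comm, smul_sub, smul_smul,
          inv_mul_cancel_left₀ h]
  rw [hX, mul_assoc, sub_mul, smul_blockT₁_mul_self hq h, smul_mul_assoc, one_mul,
    add_sub_cancel_left, mul_one]

theorem blockT₂_intertwines_blockX₂_mul (hq : q ^ 4 = -1) :
    (blockT₂ q - (q + q ^ 3) • (blockC₂ q * blockC₃ q)) * blockX₂ q * blockT₂ q = -1 := by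
  rw [blockT₂_intertwines_blockX₂ hq, neg_mul, sub_mul, blockT₂_mul_self, smul_mul_assoc,
    one_mul, add_sub_cancel_left]

end Field

end HeckeClifford

open HeckeClifford

/-- Lemma 5.15: the 8-dimensional matrix realization of `L(001)` for `q` a primitive 8th root
of unity satisfies all the defining relations of the affine Hecke–Clifford superalgebra `H₃`
with parameter `ξ = q − q⁻¹`; moreover `X₁⁻¹ = 2E₈ − X₁`, `X₂⁻¹ = 2E₈ − X₂`, `X₃⁻¹ = X₃`,
and `1 + q² ≠ 0`. (The `8×8` matrices are written in `4×4` blocks, indexed by `Fin 4 ⊕ Fin 4`.) -/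
theorem stmt_12 {F : Type*} [Field F] (q : F) (hq : IsPrimitiveRoot q 8)
    (ξ : F) (hξ : ξ = q - q⁻¹)
    (MX₁ MX₂ MC₁ MC₂ MC₃ MT₁ MT₂d : Matrix (Fin 4) (Fin 4) F)
    (hMX₁ : MX₁ = !![1, 0, -2, 2*q; 0, 1, 2*q, -2*q^2; 2, 2*q⁻¹, 1, 0; 2*q⁻¹, -2*q^2, 0, 1])
    (hMX₂ : MX₂ = !![-1, -2*q⁻¹, 0, 0; 2*q, 3, 0, 0; 0, 0, -1, 2*q; 0, 0, -2*q⁻¹, 3])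
    (hMC₁ : MC₁ = !![q^2, 0, 2*q^2, 2*q⁻¹; 0, q^2, 2*q⁻¹, -2; 2*q^2, 2*q, -q^2, 0;
      2*q, 2, 0, -q^2])
    (hMC₂ : MC₂ = !![0, 0, q^2, 0; 0, 0, 2*q⁻¹, -1; q^2, 0, 0, 0; 2*q, 1, 0, 0])
    (hMC₃ : MC₃ = !![0, 0, -1, 0; 0, 0, 0, q^2; 1, 0, 0, 0; 0, q^2, 0, 0])
    (hMT₁ : MT₁ = !![q^3, q^2, -q^3, -1; 0, q^3, 0, q; q^3, q^2, q^3, 1; 0, q, 0, q^3])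
    -- `MT₂d` is the `4×4` block-diagonal matrix with two copies of `MT₂ = [[q³+q,1],[1,0]]`
    (hMT₂d : MT₂d = !![q^3 + q, 1, 0, 0; 1, 0, 0, 0; 0, 0, q^3 + q, 1; 0, 0, 1, 0])
    (X₁ X₂ X₃ C₁ C₂ C₃ T₁ T₂ : Matrix (Fin 4 ⊕ Fin 4) (Fin 4 ⊕ Fin 4) F)
    (hX₁ : X₁ = fromBlocks MX₁ 0 0 MX₁)
    (hX₂ : X₂ = fromBlocks MX₂ 0 0 MX₂)
    (hX₃ : X₃ = -1)
    (hC₁ : C₁ = fromBlocks 0 MC₁ (-MC₁) 0)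
    (hC₂ : C₂ = fromBlocks 0 MC₂ (-MC₂) 0)
    (hC₃ : C₃ = fromBlocks 0 MC₃ (-MC₃) 0)
    (hT₁ : T₁ = (1 + q^2)⁻¹ • fromBlocks MT₁ 0 0 MT₁)
    (hT₂ : T₂ = fromBlocks MT₂d 0 0 MT₂d) :
    (1 + q ^ 2 ≠ 0) ∧
    -- invertibility: `X₁⁻¹ = 2E₈ − X₁`, `X₂⁻¹ = 2E₈ − X₂`, `X₃⁻¹ = X₃`
    X₁ * (2 - X₁) = 1 ∧ (2 - X₁) * X₁ = 1 ∧
    X₂ * (2 - X₂) = 1 ∧ (2 - X₂) * X₂ = 1 ∧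
    X₃ * X₃ = 1 ∧
    -- the `Xᵢ` pairwise commute
    X₁ * X₂ = X₂ * X₁ ∧ X₁ * X₃ = X₃ * X₁ ∧ X₂ * X₃ = X₃ * X₂ ∧
    -- Clifford relations
    C₁ * C₁ = 1 ∧ C₂ * C₂ = 1 ∧ C₃ * C₃ = 1 ∧
    C₁ * C₂ = -(C₂ * C₁) ∧ C₁ * C₃ = -(C₃ * C₁) ∧ C₂ * C₃ = -(C₃ * C₂) ∧
    -- Hecke relations
    T₁ * T₁ = ξ • T₁ + 1 ∧ T₂ * T₂ = ξ • T₂ + 1 ∧ T₁ * T₂ * T₁ = T₂ * T₁ * T₂ ∧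
    -- mixed `C`/`X` relations (`CᵢXᵢ = Xᵢ⁻¹Cᵢ` and `CᵢXⱼ = XⱼCᵢ` for `i ≠ j`)
    C₁ * X₁ = (2 - X₁) * C₁ ∧ C₂ * X₂ = (2 - X₂) * C₂ ∧ C₃ * X₃ = X₃ * C₃ ∧
    C₁ * X₂ = X₂ * C₁ ∧ C₁ * X₃ = X₃ * C₁ ∧ C₂ * X₁ = X₁ * C₂ ∧
    C₂ * X₃ = X₃ * C₂ ∧ C₃ * X₁ = X₁ * C₃ ∧ C₃ * X₂ = X₂ * C₃ ∧
    -- mixed `T`/`C` and `T`/`X` relations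
    T₁ * C₁ = C₂ * T₁ ∧ (T₁ + ξ • (C₁ * C₂)) * X₁ * T₁ = X₂ ∧
    T₂ * C₂ = C₃ * T₂ ∧ (T₂ + ξ • (C₂ * C₃)) * X₂ * T₂ = X₃ ∧
    T₁ * C₃ = C₃ * T₁ ∧ T₁ * X₃ = X₃ * T₁ ∧
    T₂ * C₁ = C₁ * T₂ ∧ T₂ * X₁ = X₁ * T₂ := by
  have hq4 : q ^ 4 = -1 := by
    have h : (q ^ 4) ^ 2 = 1 := by rw [← pow_mul]; exact hq.pow_eq_one
    exact (eq_or_eq_neg_of_sq_eq_sq _ _ (h.trans (one_pow 2).symm)).resolve_left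
      (hq.pow_ne_one_of_pos_of_lt (by norm_num) (by norm_num))
  have hinv : q⁻¹ = -q ^ 3 := inv_eq_of_mul_eq_one_right (by linear_combination -hq4)
  have h1 : 1 + q ^ 2 ≠ 0 := fun h ↦
    hq.pow_ne_one_of_pos_of_lt (l := 4) (by norm_num) (by norm_num)
      (by linear_combination (q ^ 2 - 1) * h)
  rw [hinv] at hMX₁ hMX₂ hMC₁ hMC₂ hξ
  rw [sub_neg_eq_add] at hξ
  rw [fromBlocks_smul, smul_zero] at hT₁
  have h2 : (2 : Matrix (Fin 4 ⊕ Fin 4) (Fin 4 ⊕ Fin 4) F) = fromBlocks 2 0 0 2 := by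
    rw [← one_add_one_eq_two, ← fromBlocks_one, fromBlocks_add, one_add_one_eq_two, add_zero]
  have hone : (1 : Matrix (Fin 4 ⊕ Fin 4) (Fin 4 ⊕ Fin 4) F) = fromBlocks 1 0 0 1 :=
    fromBlocks_one.symm
  replace hMX₁ : MX₁ = blockX₁ q := hMX₁
  replace hMX₂ : MX₂ = blockX₂ q := hMX₂
  replace hMC₁ : MC₁ = blockC₁ q := hMC₁
  replace hMC₂ : MC₂ = blockC₂ q := hMC₂
  replace hMC₃ : MC₃ = blockC₃ q := hMC₃
  replace hMT₁ : MT₁ = blockT₁ q := hMT₁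
  replace hMT₂d : MT₂d = blockT₂ q := hMT₂d
  subst hξ hMX₁ hMX₂ hMC₁ hMC₂ hMC₃ hMT₁ hMT₂d hX₁ hX₂ hX₃ hC₁ hC₂ hC₃ hT₁ hT₂
  have hX₁ := blockX₁_mul_two_sub hq4
  have hX₂ := blockX₂_mul_two_sub hq4
  refine ⟨h1, ?_⟩
  simp only [h2, hone, fromBlocks_multiply, fromBlocks_smul, fromBlocks_neg, fromBlocks_add,
    sub_eq_add_neg, fromBlocks_inj, mul_zero, zero_mul, add_zero, zero_add, neg_zero, smul_zero,
    mul_neg, neg_mul, neg_neg, mul_one, one_mul, smul_neg, neg_inj, and_true, true_and, and_self]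
  simp only [← sub_eq_add_neg]
  exact ⟨hX₁, mul_eq_one_comm.mp hX₁, hX₂, mul_eq_one_comm.mp hX₂, blockX₁_mul_blockX₂ hq4,
    neg_eq_iff_eq_neg.mpr (blockC₁_mul_self hq4), neg_eq_iff_eq_neg.mpr (blockC₂_mul_self hq4),
    neg_eq_iff_eq_neg.mpr (blockC₃_mul_self hq4), neg_eq_iff_eq_neg.mpr (blockC₁_mul_blockC₂ hq4),
    neg_eq_iff_eq_neg.mpr (blockC₁_mul_blockC₃ hq4),
    neg_eq_iff_eq_neg.mpr (blockC₂_mul_blockC₃ hq4),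
    smul_blockT₁_mul_self hq4 h1, blockT₂_mul_self, smul_blockT₁_braid_blockT₂ hq4 h1,
    blockC₁_mul_blockX₁ hq4, blockC₂_mul_blockX₂ hq4, blockC₁_mul_blockX₂ hq4,
    blockC₂_mul_blockX₁ hq4, blockC₃_mul_blockX₁ hq4, blockC₃_mul_blockX₂ hq4,
    by rw [smul_mul_assoc, blockT₁_mul_blockC₁ hq4, mul_smul_comm],
    smul_blockT₁_intertwines_blockX₁ hq4 h1, blockT₂_mul_blockC₂ hq4,
    blockT₂_intertwines_blockX₂_mul hq4,
    by rw [smul_mul_assoc, blockT₁_mul_blockC₃ hq4, mul_smul_comm],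
    blockT₂_mul_blockC₁ hq4, blockT₂_mul_blockX₁ hq4⟩
end

section
/- Let F be a field, q ∈ F a nonzero element with q + q⁻¹ ≠ 0, s ∈ F with s² = −1, and i, j integers with |i − j| = 1, q(i) ∈ {2, −2}, q(j) ∉ {2, −2} and q(i) ≠ q(j); put a = q(i)/2 and let b₊, b₋ ∈ F be nonzero with b₊ + b₋ = q(j) and b₊b₋ = 1. Then the 4×4 matrices over F given by X₁ = X₃ = a·E₄, X₂ = diag(b₊, b₋, b₊, b₋), C₁ = [[0,0,1,0],[0,0,0,1],[1,0,0,0],[0,1,0,0]], C₂ = [[0,0,0,−1],[0,0,1,0],[0,1,0,0],[−1,0,0,0]], C₃ = [[0,0,s,0],[0,0,0,−s],[−s,0,0,0],[0,s,0,0]], and T₁ = (ξ/(q(j) − q(i)))·[[b₊−a, a−b₋, 0, 0],[b₊−a, b₋−a, 0, 0],[0, 0, b₊−a, b₋−a],[0, 0, a−b₊, b₋−a]] satisfy all the defining relations of the affine Hecke–Clifford superalgebra H₃ with parameter ξ that do not involve T₂; that is, the X's pairwise commute and are invertible (X₁⁻¹ = X₁, X₃⁻¹ = X₃, X₂⁻¹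 = diag(b₋, b₊, b₋, b₊)); C₁² = C₂² = C₃² = 1 and the C's pairwise anticommute; C_kX_k = X_k⁻¹C_k and C_kX_m = X_mC_k for k ≠ m; T₁² = ξT₁ + 1, T₁C₁ = C₂T₁, (T₁ + ξC₁C₂)X₁T₁ = X₂, T₁C₃ = C₃T₁, and T₁X₃ = X₃T₁. -/
/-- If `q(i) = 2a` with `a² = 1`, then any neighbouring value `q(j) ≠ q(i)` equals
`2a(1 + ξ²)` with `ξ = q - q⁻¹`. -/
theorem qval_neighbour {F : Type*} [Field F] {q : F} (hq : q ≠ 0) (hsum : q + q⁻¹ ≠ 0)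
    {i j : ℤ} (hij : |i - j| = 1) {a : F} (ha : a ^ 2 = 1) (h2 : (2 : F) ≠ 0)
    (hqi : qval q i = 2 * a) (hne : qval q i ≠ qval q j) :
    qval q j = 2 * a * (1 + (q - q⁻¹) ^ 2) := by
  have hqq : q * q⁻¹ = 1 := mul_inv_cancel₀ hq
  obtain ⟨x, hx⟩ : ∃ x, x = q ^ (2 * i + 1) := ⟨_, rfl⟩
  obtain ⟨y, hy⟩ : ∃ y, y = q ^ (-(2 * i + 1)) := ⟨_, rfl⟩
  have hxy : x * y = 1 := by rw [hx, hy, ← zpow_add₀ hq]; simp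
  have hxy_sum : x + y = a * (q + q⁻¹) := by
    rw [qval, ← hx, ← hy, div_eq_iff hsum] at hqi
    exact mul_left_cancel₀ h2 (by linear_combination hqi)
  have hroots : (x - a * q) * (x - a * q⁻¹) = 0 := by
    linear_combination x * hxy_sum - hxy + a ^ 2 * hqq + ha
  have hj : qval q j * (q + q⁻¹) = 2 * (x * q ^ 2 + y * q⁻¹ ^ 2) ∨
      qval q j * (q + q⁻¹) = 2 * (x * q⁻¹ ^ 2 + y * q ^ 2) := by
    rw [qval, div_mul_cancel₀ _ hsum, hx, hy]
    rcases (abs_eq zero_le_one).1 hij with h | h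
    · right
      have h₁ : 2 * j + 1 = (2 * i + 1) + -2 := by lia
      have h₂ : -(2 * j + 1) = -(2 * i + 1) + 2 := by lia
      rw [h₂, h₁, zpow_add₀ hq _ (-2), zpow_add₀ hq _ 2, zpow_neg q 2, inv_pow]
      norm_cast
    · left
      have h₁ : 2 * j + 1 = (2 * i + 1) + 2 := by lia
      have h₂ : -(2 * j + 1) = -(2 * i + 1) + -2 := by lia
      rw [h₂, h₁, zpow_add₀ hq _ 2, zpow_add₀ hq _ (-2), zpow_neg q 2, inv_pow]
      norm_cast
  have hcases : x = a * q ∧ y = a * q⁻¹ ∨ x = a * q⁻¹ ∧ y = a * q := by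
    rcases mul_eq_zero.1 hroots with h | h
    · exact .inl ⟨by linear_combination h, by linear_combination hxy_sum - h⟩
    · exact .inr ⟨by linear_combination h, by linear_combination hxy_sum - h⟩
  generalize q⁻¹ = r at hsum hqq hj hcases ⊢
  have key : qval q j * (q + r) = 2 * a * (q ^ 3 + r ^ 3) ∨
      qval q j * (q + r) = 2 * a * (q + r) := by
    rcases hcases with ⟨h, h'⟩ | ⟨h, h'⟩ <;> rcases hj with hj | hj <;> rw [h, h'] at hj
    · exact .inl (by linear_combination hj)
    · exact .inr (by linear_combination hj + 2 * a * (q + r) * hqq)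
    · exact .inr (by linear_combination hj + 2 * a * (q + r) * hqq)
    · exact .inl (by linear_combination hj)
  rcases key with h | h
  · apply mul_right_cancel₀ hsum
    linear_combination h + 2 * a * (q + r) * hqq
  · exact absurd (hqi.trans (mul_right_cancel₀ hsum h).symm) hne

/-- The block matrix `T` with diagonal blocks of trace `ξ` and determinant `-1` satisfies the
quadratic Hecke relation. -/
theorem hecke_block_sq {F : Type*} [Field F] {c ξ a bp bm : F}
    (htrace : c * (bp + bm - 2 * a) = ξ)
    (hdet : 2 * c ^ 2 * ((bp - a) * (bm - a)) = -1)
    {T : Matrix (Fin 4) (Fin 4) F}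
    (hT : T = c • !![bp - a, a - bm, 0, 0;
        bp - a, bm - a, 0, 0;
        0, 0, bp - a, bm - a;
        0, 0, a - bp, bm - a]) :
    T * T = ξ • T + 1 := by
  subst hT
  ext k l
  fin_cases k <;> fin_cases l <;> simp
  all_goals first
    | linear_combination (c * (bp - a)) * htrace - hdet
    | linear_combination (c * (bm - a)) * htrace - hdet
    | linear_combination (c * (bp - a)) * htrace
    | linear_combination (-c * (bp - a)) * htrace
    | linear_combination (c * (bm - a)) * htrace
    | linear_combination (-c * (bm - a)) * htrace

/-- The relation `(T + ξ C₁ C₂) X₁ T = X₂` for scalar `X₁ = a`, after replacing `T²` by `ξ T + 1`. -/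
theorem hecke_block_intertwine {F : Type*} [Field F] {c ξ a bp bm : F}
    (h : 2 * a * ξ * c = 1) :
    a • (ξ • (c • !![bp - a, a - bm, 0, 0;
        bp - a, bm - a, 0, 0;
        0, 0, bp - a, bm - a;
        0, 0, a - bp, bm - a]) + 1 +
      ξ • (!![0, 0, 1, 0; 0, 0, 0, 1; 1, 0, 0, 0; 0, 1, 0, 0] *
        !![0, 0, 0, -1; 0, 0, 1, 0; 0, 1, 0, 0; -1, 0, 0, 0] *
        (c • !![bp - a, a - bm, 0, 0;
        bp - a, bm - a, 0, 0;
        0, 0, bp - a, bm - a;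
        0, 0, a - bp, bm - a]))) =
    !![bp, 0, 0, 0; 0, bm, 0, 0; 0, 0, bp, 0; 0, 0, 0, bm] := by
  ext k l
  fin_cases k <;> fin_cases l <;> simp
  all_goals first
    | linear_combination (bp - a) * h
    | linear_combination (bm - a) * h
    | skip
  all_goals (try right); ring

set_option maxHeartbeats 1600000 in
/-- The computational core of Lemma 5.9: for `|i − j| = 1`, `q(i) = ±2`, `q(j) ≠ ±2`,
`q(i) ≠ q(j)`, `s² = −1`, `a = q(i)/2` and `b₊, b₋` the roots of `x² − q(j)x + 1`, the
displayed `4×4` matrices satisfy all the defining relations of the affine Hecke–Clifford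
superalgebra `H₃` with parameter `ξ = q − q⁻¹` that do not involve `T₂`
(here `X₁⁻¹ = X₁`, `X₃⁻¹ = X₃`, `X₂⁻¹ = diag(b₋, b₊, b₋, b₊)`). -/
theorem stmt_14 {F : Type*} [Field F] (q : F) (hq : q ≠ 0) (hsum : q + q⁻¹ ≠ 0)
    (s : F) (hs : s ^ 2 = -1)
    (i j : ℤ) (hij : |i - j| = 1)
    (hqi : qval q i = 2 ∨ qval q i = -2)
    (hqj : qval q j ≠ 2 ∧ qval q j ≠ -2)
    (hne : qval q i ≠ qval q j)
    (ξ : F) (hξ : ξ = q - q⁻¹)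
    (a : F) (ha : a = qval q i / 2)
    (bp bm : F) (hbp : bp ≠ 0) (hbm : bm ≠ 0)
    (hbsum : bp + bm = qval q j) (hbprod : bp * bm = 1)
    (X₁ X₂ X₃ X₂inv C₁ C₂ C₃ T₁ : Matrix (Fin 4) (Fin 4) F)
    (hX₁ : X₁ = a • (1 : Matrix (Fin 4) (Fin 4) F))
    (hX₃ : X₃ = a • (1 : Matrix (Fin 4) (Fin 4) F))
    (hX₂ : X₂ = !![bp, 0, 0, 0; 0, bm, 0, 0; 0, 0, bp, 0; 0, 0, 0, bm])
    (hX₂inv : X₂inv = !![bm, 0, 0, 0; 0, bp, 0, 0; 0, 0, bm, 0; 0, 0, 0, bp])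
    (hC₁ : C₁ = !![0, 0, 1, 0; 0, 0, 0, 1; 1, 0, 0, 0; 0, 1, 0, 0])
    (hC₂ : C₂ = !![0, 0, 0, -1; 0, 0, 1, 0; 0, 1, 0, 0; -1, 0, 0, 0])
    (hC₃ : C₃ = !![0, 0, s, 0; 0, 0, 0, -s; -s, 0, 0, 0; 0, s, 0, 0])
    (hT₁ : T₁ = (ξ / (qval q j - qval q i)) •
      !![bp - a, a - bm, 0, 0;
         bp - a, bm - a, 0, 0;
         0, 0, bp - a, bm - a;
         0, 0, a - bp, bm - a]) :
    -- the `Xᵢ` pairwise commute and are invertible (`X₁⁻¹ = X₁`, `X₃⁻¹ = X₃`)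
    X₁ * X₂ = X₂ * X₁ ∧ X₁ * X₃ = X₃ * X₁ ∧ X₂ * X₃ = X₃ * X₂ ∧
    X₁ * X₁ = 1 ∧ X₃ * X₃ = 1 ∧ X₂ * X₂inv = 1 ∧ X₂inv * X₂ = 1 ∧
    -- Clifford relations
    C₁ * C₁ = 1 ∧ C₂ * C₂ = 1 ∧ C₃ * C₃ = 1 ∧
    C₁ * C₂ = -(C₂ * C₁) ∧ C₁ * C₃ = -(C₃ * C₁) ∧ C₂ * C₃ = -(C₃ * C₂) ∧
    -- mixed `C`/`X` relations (`CₖXₖ = Xₖ⁻¹Cₖ` and `CₖXₘ = XₘCₖ` for `k ≠ m`)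
    C₁ * X₁ = X₁ * C₁ ∧ C₂ * X₂ = X₂inv * C₂ ∧ C₃ * X₃ = X₃ * C₃ ∧
    C₁ * X₂ = X₂ * C₁ ∧ C₁ * X₃ = X₃ * C₁ ∧ C₂ * X₁ = X₁ * C₂ ∧
    C₂ * X₃ = X₃ * C₂ ∧ C₃ * X₁ = X₁ * C₃ ∧ C₃ * X₂ = X₂ * C₃ ∧
    -- relations involving `T₁`
    T₁ * T₁ = ξ • T₁ + 1 ∧ T₁ * C₁ = C₂ * T₁ ∧
    (T₁ + ξ • (C₁ * C₂)) * X₁ * T₁ = X₂ ∧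
    T₁ * C₃ = C₃ * T₁ ∧ T₁ * X₃ = X₃ * T₁ := by
  have h2 : (2 : F) ≠ 0 := fun h => hne (by simp [qval, h])
  have hqi_a : qval q i = 2 * a := by rw [ha]; field_simp
  have ha2 : a ^ 2 = 1 := by
    rcases hqi with h | h <;> rw [ha, h] <;> field_simp
  have hqj_a := qval_neighbour hq hsum hij ha2 h2 hqi_a hne
  have hδ : qval q j - qval q i ≠ 0 := sub_ne_zero.2 hne.symm
  obtain ⟨c, hc⟩ : ∃ c, c = ξ / (qval q j - qval q i) := ⟨_, rfl⟩
  have hcδ : c * (bp + bm - 2 * a) = ξ := by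
    rw [hc, hbsum, ← hqi_a, div_mul_cancel₀ _ hδ]
  have hcξ : 2 * a * ξ * c = 1 := by
    rw [hc, mul_div_assoc', div_eq_one_iff_eq hδ, hqj_a, hqi_a, hξ]
    ring
  have hprod : (bp - a) * (bm - a) = -a * (bp + bm - 2 * a) := by
    linear_combination hbprod - ha2
  have hdet : 2 * c ^ 2 * ((bp - a) * (bm - a)) = -1 := by
    linear_combination 2 * c ^ 2 * hprod - 2 * a * c * hcδ - hcξ
  have hTT : T₁ * T₁ = ξ • T₁ + 1 := by
    rw [hT₁, ← hc]
    exact hecke_block_sq hcδ hdet rfl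
  have hTXT : (T₁ + ξ • (C₁ * C₂)) * X₁ * T₁ = X₂ := by
    have : (T₁ + ξ • (C₁ * C₂)) * X₁ * T₁ = a • (ξ • T₁ + 1 + ξ • (C₁ * C₂ * T₁)) := by
      rw [hX₁, ← hTT]
      simp [add_mul]
    rw [this, hT₁, ← hc, hC₁, hC₂, hX₂]
    exact hecke_block_intertwine hcξ
  have hX₁X₁ : X₁ * X₁ = 1 := by rw [hX₁, smul_mul_smul_comm, one_mul, ← sq, ha2, one_smul]
  have hC₃C₃ : C₃ * C₃ = 1 := by
    rw [hC₃]
    ext k l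
    fin_cases k <;> fin_cases l <;> simp
    all_goals linear_combination -hs
  have hX₁_comm (M : Matrix (Fin 4) (Fin 4) F) : X₁ * M = M * X₁ := by simp [hX₁]
  obtain rfl : X₃ = X₁ := hX₃.trans hX₁.symm
  rw [← hc] at hT₁
  refine ⟨hX₁_comm _, rfl, (hX₁_comm _).symm, hX₁X₁, hX₁X₁, ?_, ?_, ?_, ?_, hC₃C₃, ?_, ?_, ?_,
    (hX₁_comm _).symm, ?_, (hX₁_comm _).symm, ?_, (hX₁_comm _).symm, (hX₁_comm _).symm,
    (hX₁_comm _).symm, (hX₁_comm _).symm, ?_, hTT, ?_, hTXT, ?_, (hX₁_comm _).symm⟩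
  all_goals
    simp only [hX₂, hX₂inv, hC₁, hC₂, hC₃, hT₁]
    ext k l
    fin_cases k <;> fin_cases l <;> simp [hbprod, mul_comm bm bp] <;> ring
end
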